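/- Let S ⊆ (𝔽_2²)^n be a subgroup with independent generators given by the rows of a matrix G(S), let L ⊆ (𝔽_2²)^n be a subgroup with L ∩ S = {0} generated by the independent rows ℓ^(1),...,ℓ^(2k) of a matrix G(L), and set N = L + S. Suppose the stacked matrix G(N) = [G(S); G(L)] is in restricted trellis-oriented form: G(N) has the L-property (for every index t, at most two rows of G(N) have left index t, and if two rows share left index t their entries at t differ) and G(S) is an LR-matrix (the same condition also for right indices of G(S)). For each row ℓ^(i) let T̂(ℓ^(i)) be the 2-goal multi-goal atomic trellis whose two paths, labeled by the all-zero word and by ℓ^(i), end at two distinct goal vertices, and let T_S be the minimal (single-goal) trellis of the code S. Then the Shannon product T̂(ℓ^(1)) × ... × T̂(ℓ^(2k)) × T_S is a reduced biproper multi-goal trellis with 2^{2k} goal vertices representing the joint code whose underlying code is N and whose subcodes are the 2^{2k} cosets of S in N; hence it is the unique minimal multi-goal trellis of this joint code. -/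

import Mathlib

/-- A trellis of depth `n` over the alphabet `A`.  The vertex classes are
`V 0, …, V n` (classes `V t` for `t > n` are irrelevant junk), every edge of the
`t`-th section goes from `V t` to `V (t+1)` and carries a label in `A`, and
`V 0` consists of the single root vertex. -/
structure Trellis (A : Type) (n : ℕ) : Type 1 where
  V : ℕ → Type
  instFin : ∀ t, Fintype (V t)
  instDec : ∀ t, DecidableEq (V t)
  root : V 0
  root_unique : ∀ v : V 0, v = root
  E : ∀ t : ℕ, Finset (V t × V (t + 1) × A)

attribute [instance] Trellis.instFin Trellis.instDec

namespace Trellis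

variable {A : Type} {n : ℕ}

/-- A path of a trellis: a sequence of `n` consecutive edges starting at the root
(the start vertex is automatically the root since `V 0` is a singleton). -/
structure Path (T : Trellis A n) where
  vert : ∀ t : ℕ, t ≤ n → T.V t
  label : Fin n → A
  mem : ∀ (t : ℕ) (h : t < n),
    (vert t h.le, vert (t + 1) h, label ⟨t, h⟩) ∈ T.E t

/-- The set of words of paths of `T`. -/
def Words (T : Trellis A n) : Set (Fin n → A) := {w | ∃ p : T.Path, p.label = w}

/-- The set of words of paths of `T` ending at the goal vertex `g ∈ V n`. -/
def WordsTo (T : Trellis A n) (g : T.V n) : Set (Fin n → A) :=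
  {w | ∃ p : T.Path, p.vert n (le_refl n) = g ∧ p.label = w}

/-- `T` has a single goal vertex. -/
def SingleGoal (T : Trellis A n) : Prop := ∀ v w : T.V n, v = w

/-- `T` is a (single-goal) trellis presenting the block code `C`. -/
def Presents (T : Trellis A n) (C : Set (Fin n → A)) : Prop :=
  T.SingleGoal ∧ T.Words = C

/-- Every vertex of `T` lies on some path. -/
def Reduced (T : Trellis A n) : Prop :=
  ∀ (t : ℕ) (h : t ≤ n) (v : T.V t), ∃ p : T.Path, p.vert t h = v

/-- `T` has no right twins and no left twins. -/
def Biproper (T : Trellis A n) : Prop :=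
  (∀ t, t < n → ∀ (u : T.V t) (v v' : T.V (t + 1)) (a : A),
      (u, v, a) ∈ T.E t → (u, v', a) ∈ T.E t → v = v') ∧
  (∀ t, t < n → ∀ (u u' : T.V t) (v : T.V (t + 1)) (a : A),
      (u, v, a) ∈ T.E t → (u', v, a) ∈ T.E t → u = u')

/-- Total number of vertices of `T` (vertex classes `0,…,n`). -/
def vertCard (T : Trellis A n) : ℕ := ∑ t ∈ Finset.range (n + 1), Fintype.card (T.V t)

/-- Total number of edges of `T` (sections `1,…,n`). -/
def edgeCard (T : Trellis A n) : ℕ := ∑ t ∈ Finset.range n, (T.E t).card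

/-- An isomorphism of trellises: bijections of the vertex classes preserving
the edges together with their labels. -/
structure Iso (T T' : Trellis A n) where
  equiv : ∀ t : ℕ, t ≤ n → (T.V t ≃ T'.V t)
  mem_iff : ∀ (t : ℕ) (h : t < n) (u : T.V t) (v : T.V (t + 1)) (a : A),
    (u, v, a) ∈ T.E t ↔ (equiv t h.le u, equiv (t + 1) h v, a) ∈ T'.E t

/-- `T` is a minimal trellis presenting `C`. -/
def MinimalFor (T : Trellis A n) (C : Set (Fin n → A)) : Prop :=
  T.Presents C ∧ ∀ T' : Trellis A n, T'.Presents C → T.vertCard ≤ T'.vertCard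

/-- A multi-goal trellis `T` represents the joint code with subcode list `Cs`
if the goal vertices can be indexed by `ι` in such a way that the sub-trellis
of the `i`-th goal vertex presents `Cs i`. -/
def Represents {ι : Type} (T : Trellis A n) (Cs : ι → Set (Fin n → A)) : Prop :=
  ∃ φ : ι ≃ T.V n, ∀ i, T.WordsTo (φ i) = Cs i

/-- `T` is a minimal multi-goal trellis representing the joint code `Cs`. -/
def MinimalRep {ι : Type} (T : Trellis A n) (Cs : ι → Set (Fin n → A)) : Prop :=
  T.Represents Cs ∧ ∀ T' : Trellis A n, T'.Represents Cs → T.vertCard ≤ T'.vertCard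

end Trellis

/-- A block code `C ⊆ A^n` is rectangular if for every `t ∈ {1,…,n-1}`,
whenever `(a,c), (a,d), (b,c) ∈ C` (splitting words into length-`t` prefixes
and length-`(n-t)` suffixes), then also `(b,d) ∈ C`.  Here `w1 = (a,c)`,
`w2 = (a,d)`, `w3 = (b,c)` and the conclusion is `(b,d) ∈ C`. -/
def Rectangular {A : Type} {n : ℕ} (C : Set (Fin n → A)) : Prop :=
  ∀ t : ℕ, 1 ≤ t → t < n → ∀ w1 w2 w3 : Fin n → A,
    w1 ∈ C → w2 ∈ C → w3 ∈ C →
    (∀ i : Fin n, (i : ℕ) < t → w1 i = w2 i) →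
    (∀ i : Fin n, t ≤ (i : ℕ) → w1 i = w3 i) →
    (fun i : Fin n => if (i : ℕ) < t then w3 i else w2 i) ∈ C

/-- The Shannon product of two trellises over an additively written abelian
group alphabet: vertex classes are the products of the vertex classes, and each
pair of `t`-th-section edges `(v'₁, v'₂, a')`, `(v''₁, v''₂, a'')` yields the
edge `((v'₁,v''₁), (v'₂,v''₂), a' + a'')`. -/
def Trellis.shannonProd {A : Type} [AddCommGroup A] [DecidableEq A] {n : ℕ}
    (T T' : Trellis A n) : Trellis A n where
  V := fun t => T.V t × T'.V t
  instFin := fun _ => inferInstance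
  instDec := fun _ => inferInstance
  root := (T.root, T'.root)
  root_unique := fun v => by
    obtain ⟨a, b⟩ := v
    rw [T.root_unique a, T'.root_unique b]
  E := fun t =>
    (T.E t ×ˢ T'.E t).image
      (fun e => ((e.1.1, e.2.1), (e.1.2.1, e.2.2.1), e.1.2.2 + e.2.2.2))

/-- The effective single-qubit Pauli group, identified with the additive group
`𝔽₂²` via `I ↔ (0,0)`, `X ↔ (1,0)`, `Z ↔ (0,1)`, `Y ↔ (1,1)`. -/
abbrev Pauli : Type := ZMod 2 × ZMod 2

/-- `t` is the left index of `g`: the least position where `g` is nonzero. -/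
def IsLeftIndex {n : ℕ} (g : Fin n → Pauli) (t : Fin n) : Prop :=
  g t ≠ 0 ∧ ∀ s : Fin n, s < t → g s = 0

/-- `t` is the right index of `g`: the greatest position where `g` is nonzero. -/
def IsRightIndex {n : ℕ} (g : Fin n → Pauli) (t : Fin n) : Prop :=
  g t ≠ 0 ∧ ∀ s : Fin n, t < s → g s = 0

/-- The matrix with rows `G i` has the L-property: for every index `t`, at most
two rows have left index `t`, and two distinct rows sharing the left index `t`
have different entries at `t`. -/
def LProperty {r n : ℕ} (G : Fin r → Fin n → Pauli) : Prop :=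
  (∀ (t : Fin n) (i j : Fin r), i ≠ j →
      IsLeftIndex (G i) t → IsLeftIndex (G j) t → G i t ≠ G j t) ∧
  (∀ (t : Fin n) (i j l : Fin r), i ≠ j → i ≠ l → j ≠ l →
      IsLeftIndex (G i) t → IsLeftIndex (G j) t → ¬ IsLeftIndex (G l) t)

/-- The matrix with rows `G i` has the R-property (same condition for right
indices). -/
def RProperty {r n : ℕ} (G : Fin r → Fin n → Pauli) : Prop :=
  (∀ (t : Fin n) (i j : Fin r), i ≠ j →
      IsRightIndex (G i) t → IsRightIndex (G j) t → G i t ≠ G j t) ∧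
  (∀ (t : Fin n) (i j l : Fin r), i ≠ j → i ≠ l → j ≠ l →
      IsRightIndex (G i) t → IsRightIndex (G j) t → ¬ IsRightIndex (G l) t)

/-- `G` is an LR-matrix (is in trellis-oriented form). -/
def LRMatrix {r n : ℕ} (G : Fin r → Fin n → Pauli) : Prop :=
  LProperty G ∧ RProperty G

namespace Trellis

section Paths

variable {A : Type} {n : ℕ} {T T' : Trellis A n}

/-- The path which follows `p` up to level `t`, then an edge from `p` to `q`, and then `q`. -/
def Path.splice (p q : T.Path) (t : ℕ) (ht : t < n) (a : A)
    (he : (p.vert t ht.le, q.vert (t + 1) ht, a) ∈ T.E t) : T.Path where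
  vert s hs := if s ≤ t then p.vert s hs else q.vert s hs
  label s := if (s : ℕ) < t then p.label s else if (s : ℕ) = t then a else q.label s
  mem s hs := by
    rcases lt_trichotomy s t with h | h | h
    · simpa [h, h.le, Nat.succ_le_of_lt h] using p.mem s hs
    · subst h
      simpa using he
    · have h1 : ¬ s < t := by omega
      have h2 : ¬ s = t := by omega
      have h3 : ¬ s ≤ t := by omega
      have h4 : ¬ s + 1 ≤ t := by omega
      simpa [h1, h2, h3, h4] using q.mem s hs

/-- Through every edge of a reduced trellis passes a path, which may be chosen to follow given
paths before and after that edge. -/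
theorem exists_path_through (p q : T.Path) {t : ℕ} (ht : t < n) {u : T.V t} {v : T.V (t + 1)}
    {a : A} (he : (u, v, a) ∈ T.E t) (hp : p.vert t ht.le = u) (hq : q.vert (t + 1) ht = v) :
    ∃ x : T.Path, x.vert t ht.le = u ∧ x.vert (t + 1) ht = v ∧
      x.vert n le_rfl = q.vert n le_rfl ∧ x.label ⟨t, ht⟩ = a ∧
      (∀ i : Fin n, (i : ℕ) < t → x.label i = p.label i) ∧
      (∀ i : Fin n, t < (i : ℕ) → x.label i = q.label i) := by
  subst hp hq
  refine ⟨p.splice q t ht a he, ?_, ?_, ?_, ?_, ?_, ?_⟩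
  · simp [Path.splice]
  · simp [Path.splice]
  · simp [Path.splice, ht]
  · simp [Path.splice]
  · intro i hi
    simp [Path.splice, hi]
  · intro i hi
    have h1 : ¬ (i : ℕ) < t := by omega
    have h2 : ¬ (i : ℕ) = t := by omega
    simp [Path.splice, h1, h2]

theorem Path.vert_zero (p q : T.Path) : p.vert 0 (Nat.zero_le n) = q.vert 0 (Nat.zero_le n) :=
  (T.root_unique _).trans (T.root_unique _).symm

/-- In a biproper trellis, paths with a common initial word have common initial vertices. -/
theorem Biproper.vert_eq_of_prefix (hT : T.Biproper) (p q : T.Path) :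
    ∀ (t : ℕ) (ht : t ≤ n), (∀ i : Fin n, (i : ℕ) < t → p.label i = q.label i) →
      p.vert t ht = q.vert t ht := by
  intro t
  induction t with
  | zero => intro _ _; exact p.vert_zero q
  | succ t ih =>
    intro ht h
    have h1 := ih (by omega) (fun i hi => h i (by omega))
    have h2 := p.mem t ht
    have h3 := q.mem t ht
    rw [h ⟨t, ht⟩ (by simp), h1] at h2
    exact hT.1 t ht _ _ _ _ h2 h3

/-- In a biproper trellis, paths with a common goal and a common final word have common final
vertices. -/
theorem Biproper.vert_eq_of_suffix (hT : T.Biproper) (p q : T.Path)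
    (hg : p.vert n le_rfl = q.vert n le_rfl) (t : ℕ) (ht : t ≤ n) :
    (∀ i : Fin n, t ≤ (i : ℕ) → p.label i = q.label i) → p.vert t ht = q.vert t ht := by
  induction ht using Nat.decreasingInduction with
  | self => intro _; exact hg
  | of_succ t ht ih =>
    intro h
    have h1 := ih (fun i hi => h i (by omega))
    have h2 := p.mem t ht
    have h3 := q.mem t ht
    rw [h ⟨t, ht⟩ le_rfl, h1] at h2
    exact hT.2 t ht _ _ _ _ h2 h3

/-- Two edges leaving the same vertex differ by an entry of a difference of two words which
agree before that entry. -/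
theorem Reduced.exists_words_sub (hT : T.Reduced) {t : ℕ} (ht : t < n) {u : T.V t}
    {v v' : T.V (t + 1)} {a a' : A} (h : (u, v, a) ∈ T.E t) (h' : (u, v', a') ∈ T.E t) :
    ∃ x y : T.Path, (∀ i : Fin n, (i : ℕ) < t → x.label i = y.label i) ∧
      x.label ⟨t, ht⟩ = a ∧ y.label ⟨t, ht⟩ = a' := by
  obtain ⟨p, hp⟩ := hT t ht.le u
  obtain ⟨q, hq⟩ := hT (t + 1) ht v
  obtain ⟨q', hq'⟩ := hT (t + 1) ht v'
  obtain ⟨x, -, -, -, x4, x5, -⟩ := exists_path_through p q ht h hp hq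
  obtain ⟨y, -, -, -, y4, y5, -⟩ := exists_path_through p q' ht h' hp hq'
  exact ⟨x, y, fun i hi => (x5 i hi).trans (y5 i hi).symm, x4, y4⟩

/-- If only one word leads to each goal, then only one edge enters each vertex. -/
theorem Reduced.edge_unique_of_wordsTo_subsingleton (hT : T.Reduced) (hB : T.Biproper)
    (hW : ∀ g, (T.WordsTo g).Subsingleton) {t : ℕ} (ht : t < n) {u u' : T.V t} {v : T.V (t + 1)}
    {a a' : A} (h : (u, v, a) ∈ T.E t) (hu : (u', v, a') ∈ T.E t) : u = u' ∧ a = a' := by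
  obtain ⟨p, hp⟩ := hT t ht.le u
  obtain ⟨p', hp'⟩ := hT t ht.le u'
  obtain ⟨q, hq⟩ := hT (t + 1) ht v
  obtain ⟨x, -, -, x3, x4, -, -⟩ := exists_path_through p q ht h hp hq
  obtain ⟨y, -, -, y3, y4, -, -⟩ := exists_path_through p' q ht hu hp' hq
  have hxy : x.label = y.label := hW _ ⟨x, x3, rfl⟩ ⟨y, y3, rfl⟩
  have ha : a = a' := by rw [← x4, ← y4, hxy]
  subst ha
  exact ⟨hB.2 t ht _ _ _ _ h hu, rfl⟩

end Paths

section Minimality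

variable {A : Type} {n : ℕ} {ι : Type} {T T' : Trellis A n}

/-- The vertices `v'` and `v` lie at the same level of paths with the same word and with
corresponding goals. -/
def Corr (φ' : ι ≃ T'.V n) (φ : ι ≃ T.V n) (t : ℕ) (ht : t ≤ n) (v' : T'.V t) (v : T.V t) :
    Prop :=
  ∃ (i : ι) (p' : T'.Path) (p : T.Path), p'.vert n le_rfl = φ' i ∧ p.vert n le_rfl = φ i ∧
    p'.label = p.label ∧ p'.vert t ht = v' ∧ p.vert t ht = v

variable {Cs : ι → Set (Fin n → A)} {φ' : ι ≃ T'.V n} {φ : ι ≃ T.V n}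

theorem exists_path_same_word (hφ' : ∀ i, T'.WordsTo (φ' i) = Cs i)
    (hφ : ∀ i, T.WordsTo (φ i) = Cs i) (p : T.Path) :
    ∃ (i : ι) (p' : T'.Path), p'.vert n le_rfl = φ' i ∧ p.vert n le_rfl = φ i ∧
      p'.label = p.label := by
  obtain ⟨i, hi⟩ := φ.surjective (p.vert n le_rfl)
  have h : p.label ∈ T'.WordsTo (φ' i) := by
    rw [hφ', ← hφ]
    exact ⟨p, hi.symm, rfl⟩
  obtain ⟨p', h1, h2⟩ := h
  exact ⟨i, p', h1, hi.symm, h2⟩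

theorem exists_corr (hφ' : ∀ i, T'.WordsTo (φ' i) = Cs i)
    (hφ : ∀ i, T.WordsTo (φ i) = Cs i) (hT : T.Reduced) (t : ℕ) (ht : t ≤ n) (v : T.V t) :
    ∃ v', Corr φ' φ t ht v' v := by
  obtain ⟨p, hp⟩ := hT t ht v
  obtain ⟨i, p', h1, h2, h3⟩ := exists_path_same_word hφ' hφ p
  exact ⟨_, i, p', p, h1, h2, h3, rfl, hp⟩

theorem Corr.right_unique (hφ' : ∀ i, T'.WordsTo (φ' i) = Cs i)
    (hφ : ∀ i, T.WordsTo (φ i) = Cs i) (hT : T.Biproper) {t : ℕ} {ht : t ≤ n} {v' : T'.V t}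
    {v w : T.V t} (hv : Corr φ' φ t ht v' v) (hw : Corr φ' φ t ht v' w) : v = w := by
  obtain ⟨i, p', p, h1, h2, h3, h4, rfl⟩ := hv
  obtain ⟨j, q', q, k1, k2, k3, k4, rfl⟩ := hw
  rcases ht.lt_or_eq with ht' | rfl
  · have he := q'.mem t ht'
    rw [k4] at he
    obtain ⟨x', -, -, x3, x4, x5, x6⟩ := exists_path_through p' q' ht' he h4 rfl
    have hx : x'.label ∈ T.WordsTo (φ j) := by
      rw [hφ, ← hφ']
      exact ⟨x', x3.trans k1, rfl⟩
    obtain ⟨x, y1, y2⟩ := hx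
    have e1 : x.vert t ht = p.vert t ht := by
      refine hT.vert_eq_of_prefix _ _ _ _ fun i hi => ?_
      rw [y2, x5 i hi, h3]
    have e2 : x.vert t ht = q.vert t ht := by
      refine hT.vert_eq_of_suffix _ _ (y1.trans k2.symm) _ _ fun i hi => ?_
      rw [y2, ← k3]
      rcases hi.lt_or_eq with hi | hi
      · exact x6 i hi
      · obtain rfl : i = ⟨t, ht'⟩ := Fin.ext hi.symm
        exact x4
    exact e1.symm.trans e2
  · have : i = j := φ'.injective (by rw [← h1, ← k1, h4, k4])
    rw [h2, k2, this]

/-- A reduced biproper multi-goal trellis has at each level at most as many vertices as any other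
multi-goal trellis representing the same joint code. -/
theorem exists_injective_corr (hφ' : ∀ i, T'.WordsTo (φ' i) = Cs i)
    (hφ : ∀ i, T.WordsTo (φ i) = Cs i) (hR : T.Reduced) (hT : T.Biproper) (t : ℕ) (ht : t ≤ n) :
    ∃ f : T.V t → T'.V t, Function.Injective f ∧ ∀ v, Corr φ' φ t ht (f v) v := by
  choose f hf using exists_corr hφ' hφ hR t ht
  refine ⟨f, fun v w hvw => ?_, hf⟩
  have h := hf v
  rw [hvw] at h
  exact h.right_unique hφ' hφ hT (hf w)

theorem Reduced.minimalRep (hR : T.Reduced) (hT : T.Biproper) (hrep : T.Represents Cs) :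
    T.MinimalRep Cs := by
  refine ⟨hrep, fun T' hT' => ?_⟩
  obtain ⟨φ, hφ⟩ := hrep
  obtain ⟨φ', hφ'⟩ := hT'
  refine Finset.sum_le_sum fun t ht => ?_
  obtain ⟨f, hf, -⟩ := exists_injective_corr hφ' hφ hR hT t
    (Nat.lt_succ_iff.mp (Finset.mem_range.mp ht))
  exact Fintype.card_le_of_injective f hf

theorem Reduced.nonempty_iso (hR : T.Reduced) (hT : T.Biproper) (hrep : T.Represents Cs)
    (hT' : T'.MinimalRep Cs) : Nonempty (T.Iso T') := by
  have hle := hT'.2 T hrep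
  obtain ⟨φ, hφ⟩ := hrep
  obtain ⟨φ', hφ'⟩ := hT'.1
  choose f hf hc using exists_injective_corr hφ' hφ hR hT
  have hcard : ∀ t ∈ Finset.range (n + 1), Fintype.card (T.V t) = Fintype.card (T'.V t) := by
    have hmono : ∀ t ∈ Finset.range (n + 1), Fintype.card (T.V t) ≤ Fintype.card (T'.V t) :=
      fun t ht => Fintype.card_le_of_injective _
        (hf t (Nat.lt_succ_iff.mp (Finset.mem_range.mp ht)))
    exact (Finset.sum_eq_sum_iff_of_le hmono).mp (le_antisymm (Finset.sum_le_sum hmono) hle)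
  have hbij : ∀ t ht, Function.Bijective (f t ht) := fun t ht =>
    (Fintype.bijective_iff_injective_and_card _).mpr
      ⟨hf t ht, hcard t (Finset.mem_range.mpr (Nat.lt_succ_of_le ht))⟩
  have huniq : ∀ t ht v' v, Corr φ' φ t ht v' v → v' = f t ht v := by
    intro t ht v' v h
    obtain ⟨w, rfl⟩ := (hbij t ht).2 v'
    rw [h.right_unique hφ' hφ hT (hc t ht w)]
  refine ⟨⟨fun t ht => Equiv.ofBijective _ (hbij t ht), fun t ht u v a => ⟨fun h => ?_, fun h => ?_⟩⟩⟩
  · obtain ⟨p, hp⟩ := hR t ht.le u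
    obtain ⟨q, hq⟩ := hR (t + 1) ht v
    obtain ⟨x, x1, x2, -, x4, -, -⟩ := exists_path_through p q ht h hp hq
    obtain ⟨i, x', y1, y2, y3⟩ := exists_path_same_word hφ' hφ x
    have e1 := huniq t ht.le _ _ ⟨i, x', x, y1, y2, y3, rfl, x1⟩
    have e2 := huniq (t + 1) ht _ _ ⟨i, x', x, y1, y2, y3, rfl, x2⟩
    have hm := x'.mem t ht
    rw [e1, e2, y3, x4] at hm
    exact hm
  · obtain ⟨-, p, -, -, -, -, hp, -⟩ := hc t ht.le u
    obtain ⟨-, q, -, -, -, -, hq, -⟩ := hc (t + 1) ht v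
    obtain ⟨x', x1, x2, -, x4, -, -⟩ := exists_path_through p q ht h hp hq
    obtain ⟨i, x, y1, y2, y3⟩ := exists_path_same_word hφ hφ' x'
    have e1 := huniq t ht.le _ _ ⟨i, x', x, y2, y1, y3.symm, x1, rfl⟩
    have e2 := huniq (t + 1) ht _ _ ⟨i, x', x, y2, y1, y3.symm, x2, rfl⟩
    have hm := x.mem t ht
    rw [← (hbij t ht.le).1 e1, ← (hbij (t + 1) ht).1 e2, y3, x4] at hm
    exact hm

end Minimality

section Product

variable {A : Type} [AddCommGroup A] [DecidableEq A] {n : ℕ} {T T' : Trellis A n}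

theorem mem_shannonProd_E {t : ℕ} {u v a} :
    (u, v, a) ∈ (T.shannonProd T').E t ↔
      ∃ b b', (u.1, v.1, b) ∈ T.E t ∧ (u.2, v.2, b') ∈ T'.E t ∧ b + b' = a := by
  constructor
  · intro h
    obtain ⟨⟨⟨u1, v1, b⟩, ⟨u2, v2, b'⟩⟩, he, heq⟩ := Finset.mem_image.mp h
    obtain ⟨h1, h2⟩ := Finset.mem_product.mp he
    obtain ⟨rfl, heq'⟩ := Prod.mk.inj heq
    obtain ⟨rfl, rfl⟩ := Prod.mk.inj heq'
    exact ⟨b, b', h1, h2, rfl⟩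
  · rintro ⟨b, b', h1, h2, rfl⟩
    exact Finset.mem_image.mpr
      ⟨((u.1, v.1, b), (u.2, v.2, b')), Finset.mem_product.mpr ⟨h1, h2⟩, rfl⟩

/-- The product of two paths. -/
def Path.prod (p : T.Path) (p' : T'.Path) : (T.shannonProd T').Path where
  vert t ht := (p.vert t ht, p'.vert t ht)
  label := p.label + p'.label
  mem t ht := mem_shannonProd_E.mpr ⟨_, _, p.mem t ht, p'.mem t ht, rfl⟩

theorem Reduced.shannonProd (h : T.Reduced) (h' : T'.Reduced) : (T.shannonProd T').Reduced := by
  rintro t ht ⟨u, u'⟩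
  obtain ⟨p, rfl⟩ := h t ht u
  obtain ⟨p', rfl⟩ := h' t ht u'
  exact ⟨p.prod p', rfl⟩

theorem mem_wordsTo_shannonProd {g : T.V n} {g' : T'.V n} {w : Fin n → A} :
    w ∈ (T.shannonProd T').WordsTo (g, g') ↔
      ∃ x ∈ T.WordsTo g, ∃ y ∈ T'.WordsTo g', x + y = w := by
  constructor
  · rintro ⟨p, hp, rfl⟩
    have hm := fun i : Fin n => mem_shannonProd_E.mp (p.mem i i.2)
    choose b b' h1 h2 h3 using hm
    exact ⟨b, ⟨⟨fun t ht => (p.vert t ht).1, b, fun t ht => h1 ⟨t, ht⟩⟩, congrArg Prod.fst hp, rfl⟩,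
      b', ⟨⟨fun t ht => (p.vert t ht).2, b', fun t ht => h2 ⟨t, ht⟩⟩, congrArg Prod.snd hp, rfl⟩,
      funext h3⟩
  · rintro ⟨_, ⟨p, rfl, rfl⟩, _, ⟨p', rfl, rfl⟩, rfl⟩
    exact ⟨p.prod p', rfl, rfl⟩

/-- The product of a trellis with one word per goal and another trellis is biproper if differences
of words of the factors never cancel at a common leading entry. -/
theorem Biproper.shannonProd (hR : T.Reduced) (hB : T.Biproper) (hR' : T'.Reduced)
    (hB' : T'.Biproper) (hW : ∀ g, (T.WordsTo g).Subsingleton)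
    (hlead : ∀ (t : Fin n), ∀ x ∈ T.Words, ∀ y ∈ T.Words, ∀ x' ∈ T'.Words, ∀ y' ∈ T'.Words,
      (∀ i < t, x i = y i) → (∀ i < t, x' i = y' i) → x t + x' t = y t + y' t → x t = y t) :
    (T.shannonProd T').Biproper := by
  refine ⟨fun t ht u v w a hv hw => ?_, fun t ht u u' v a hu hu' => ?_⟩
  · obtain ⟨b, b', h1, h2, rfl⟩ := mem_shannonProd_E.mp hv
    obtain ⟨c, c', k1, k2, hcc⟩ := mem_shannonProd_E.mp hw
    obtain ⟨x, y, l1, l2, l3⟩ := hR.exists_words_sub ht h1 k1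
    obtain ⟨x', y', m1, m2, m3⟩ := hR'.exists_words_sub ht h2 k2
    have hbc := hlead ⟨t, ht⟩ _ ⟨x, rfl⟩ _ ⟨y, rfl⟩ _ ⟨x', rfl⟩ _ ⟨y', rfl⟩
      (fun i hi => l1 i hi) (fun i hi => m1 i hi) (by rw [l2, l3, m2, m3, hcc])
    rw [l2, l3] at hbc
    subst hbc
    obtain rfl := add_left_cancel hcc
    exact Prod.ext (hB.1 t ht _ _ _ _ h1 k1) (hB'.1 t ht _ _ _ _ h2 k2)
  · obtain ⟨b, b', h1, h2, rfl⟩ := mem_shannonProd_E.mp hu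
    obtain ⟨c, c', k1, k2, hcc⟩ := mem_shannonProd_E.mp hu'
    obtain ⟨e, rfl⟩ := hR.edge_unique_of_wordsTo_subsingleton hB hW ht h1 k1
    obtain rfl := add_left_cancel hcc
    exact Prod.ext e (hB'.2 t ht _ _ _ _ h2 k2)

end Product

theorem Represents.comp_equiv {A : Type} {n : ℕ} {T : Trellis A n} {ι κ : Type}
    {Cs : ι → Set (Fin n → A)} (h : T.Represents Cs) (e : κ ≃ ι) : T.Represents (Cs ∘ e) := by
  obtain ⟨φ, hφ⟩ := h
  exact ⟨e.trans φ, fun i => hφ (e i)⟩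

end Trellis

/-- Over `𝔽₂`, a combination of the rows of a matrix with the L-property vanishes up to `t` only
if all rows involved do. -/
theorem LProperty.eq_zero_of_sum_eq_zero {r n : ℕ} {G : Fin r → Fin n → Pauli} (hG : LProperty G)
    (t : Fin n) (c : Fin r → ZMod 2) (h : ∀ j ≤ t, (∑ i, c i • G i) j = 0) :
    ∀ j ≤ t, ∀ i, c i ≠ 0 → G i j = 0 := by
  intro j
  induction j using WellFoundedLT.induction with
  | _ j ih =>
  intro hj i hi
  by_contra hij
  have hleft : ∀ i, c i ≠ 0 → G i j ≠ 0 → IsLeftIndex (G i) j := fun i hc hG =>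
    ⟨hG, fun s hs => ih s hs (hs.le.trans hj) i hc⟩
  have hone : ∀ x : ZMod 2, x ≠ 0 → x = 1 := by decide
  have hterm : ∀ i, ¬ (c i ≠ 0 ∧ G i j ≠ 0) → c i • G i j = 0 := by
    intro i h
    by_cases hc : c i = 0
    · rw [hc, zero_smul]
    · rw [not_not.mp fun hG => h ⟨hc, hG⟩, smul_zero]
  have hsum : ∑ i, c i • G i j = 0 := by simpa using h j hj
  by_cases hex : ∃ i', i' ≠ i ∧ c i' ≠ 0 ∧ G i' j ≠ 0
  · obtain ⟨i', hne, hi', hij'⟩ := hex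
    have h3 : ∀ a, a ≠ i ∧ a ≠ i' → c a • G a j = 0 := fun a ha => hterm a fun hca =>
      hG.2 j i i' a hne.symm ha.1.symm ha.2.symm (hleft i hi hij) (hleft i' hi' hij')
        (hleft a hca.1 hca.2)
    rw [Fintype.sum_eq_add i i' hne.symm h3, hone _ hi, hone _ hi', one_smul, one_smul] at hsum
    have hchar : ∀ x y : Pauli, x + y = 0 → x = y := by decide
    exact hG.1 j i i' hne.symm (hleft i hi hij) (hleft i' hi' hij') (hchar _ _ hsum)
  · push Not at hex
    rw [Fintype.sum_eq_single i fun a ha => hterm a fun hca => hca.2 (hex a ha hca.1),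
      hone _ hi, one_smul] at hsum
    exact hij hsum

namespace Trellis

variable {n : ℕ}

/-- The product of atomic two-goal trellises with a trellis of a code `S` is reduced, biproper and
represents the cosets of `S`, provided that leading entries do not cancel. -/
theorem foldr_shannonProd_atomic (S : AddSubgroup (Fin n → Pauli)) (TS : Trellis Pauli n)
    (hTS : TS.Presents (S : Set (Fin n → Pauli)) ∧ TS.Reduced ∧ TS.Biproper) (m : ℕ)
    (l : Fin m → Fin n → Pauli) (Tl : Fin m → Trellis Pauli n)
    (hTl : ∀ i, (Tl i).Reduced ∧ (Tl i).Biproper ∧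
      (Tl i).Represents ![({0} : Set (Fin n → Pauli)), {l i}])
    (hlead : ∀ (t : Fin n) (c : Fin m → ZMod 2), ∀ s ∈ S,
      (∀ j ≤ t, (∑ i, c i • l i + s) j = 0) → ∀ i, c i ≠ 0 → l i t = 0) :
    ((List.ofFn Tl).foldr Trellis.shannonProd TS).Reduced ∧
    ((List.ofFn Tl).foldr Trellis.shannonProd TS).Biproper ∧
    ((List.ofFn Tl).foldr Trellis.shannonProd TS).Represents
      (fun c : Fin m → ZMod 2 => {w | ∃ s ∈ S, w = ∑ i, c i • l i + s}) := by
  induction m with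
  | zero =>
    obtain ⟨⟨hgoal, hwords⟩, hR, hB⟩ := hTS
    refine ⟨by simpa using hR, by simpa using hB, ?_⟩
    rw [List.ofFn_zero, List.foldr_nil]
    have hp : ∃ p : TS.Path, p.label = 0 := by
      have h : (0 : Fin n → Pauli) ∈ TS.Words := hwords ▸ S.zero_mem
      exact h
    obtain ⟨p, -⟩ := hp
    have : Unique (TS.V n) := ⟨⟨p.vert n le_rfl⟩, fun v => hgoal _ _⟩
    refine ⟨Equiv.ofUnique _ _, fun c => ?_⟩
    ext w
    have hw : w ∈ TS.Words ↔ w ∈ S := by rw [hwords]; rfl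
    simp only [Finset.univ_eq_empty, Finset.sum_empty, zero_add, Set.mem_ofPred_eq,
      exists_eq_right']
    rw [← hw]
    exact ⟨fun ⟨q, _, h⟩ => ⟨q, h⟩, fun ⟨q, h⟩ => ⟨q, hgoal _ _, h⟩⟩
  | succ m ih =>
    obtain ⟨hR', hB', φ', hφ'⟩ := ih (fun i => l i.succ) (fun i => Tl i.succ)
      (fun i => hTl i.succ) (fun t c s hs h i hi => by
        refine hlead t (Fin.cons 0 c) s hs (fun j hj => ?_) i.succ (by simpa using hi)
        simpa [Fin.sum_univ_succ] using h j hj)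
    obtain ⟨hR, hB, hrep⟩ := hTl 0
    have hφ : ∃ φ : ZMod 2 ≃ (Tl 0).V n, ∀ e, (Tl 0).WordsTo (φ e) = {e • l 0} := by
      obtain ⟨φ, hφ⟩ := hrep
      refine ⟨φ, fun e => (hφ e).trans ?_⟩
      have he : e = 0 ∨ e = 1 := by revert e; decide
      rcases he with rfl | rfl
      · rw [zero_smul]; rfl
      · rw [one_smul]; rfl
    obtain ⟨φ, hφ⟩ := hφ
    rw [List.ofFn_succ, List.foldr_cons]
    generalize (List.ofFn fun i => Tl i.succ).foldr Trellis.shannonProd TS = T' at *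
    have hW : ∀ g, ((Tl 0).WordsTo g).Subsingleton := by
      intro g
      obtain ⟨e, rfl⟩ := φ.surjective g
      rw [hφ e]
      exact Set.subsingleton_singleton
    have hwords : ∀ x ∈ (Tl 0).Words, ∃ e : ZMod 2, x = e • l 0 := by
      rintro _ ⟨p, rfl⟩
      obtain ⟨e, he⟩ := φ.surjective (p.vert n le_rfl)
      have : p.label ∈ (Tl 0).WordsTo (φ e) := ⟨p, he.symm, rfl⟩
      rw [hφ] at this
      exact ⟨e, this⟩
    have hwords' : ∀ x ∈ T'.Words, ∃ c : Fin m → ZMod 2, ∃ s ∈ S,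
        x = ∑ i, c i • l i.succ + s := by
      rintro _ ⟨p, rfl⟩
      obtain ⟨c, hc⟩ := φ'.surjective (p.vert n le_rfl)
      have : p.label ∈ T'.WordsTo (φ' c) := ⟨p, hc.symm, rfl⟩
      rw [hφ'] at this
      exact ⟨c, this⟩
    refine ⟨hR.shannonProd hR', Biproper.shannonProd hR hB hR' hB' hW ?_, ?_⟩
    · intro t x hx y hy x' hx' y' hy' h1 h2 h3
      obtain ⟨e, rfl⟩ := hwords x hx
      obtain ⟨f, rfl⟩ := hwords y hy
      obtain ⟨c, s, hs, rfl⟩ := hwords' x' hx'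
      obtain ⟨d, s', hs', rfl⟩ := hwords' y' hy'
      by_cases hef : e - f = 0
      · rw [sub_eq_zero.mp hef]
      have key : l 0 t = 0 := by
        refine hlead t (Fin.cons (e - f) (c - d)) (s - s') (S.sub_mem hs hs') (fun j hj => ?_) 0
          (by simpa using hef)
        have hsum : ∑ i, (Fin.cons (e - f) (c - d) : Fin (m + 1) → ZMod 2) i • l i + (s - s') =
            (e • l 0 + (∑ i, c i • l i.succ + s)) - (f • l 0 + (∑ i, d i • l i.succ + s')) := by
          simp only [Fin.sum_univ_succ, Fin.cons_zero, Fin.cons_succ, Pi.sub_apply, sub_smul,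
            Finset.sum_sub_distrib]
          abel
        rw [hsum, Pi.sub_apply, sub_eq_zero, Pi.add_apply (e • l 0), Pi.add_apply (f • l 0)]
        rcases hj.lt_or_eq with hj | rfl
        · rw [h1 j hj, h2 j hj]
        · exact h3
      simp [key]
    · refine ⟨(Fin.consEquiv fun _ => ZMod 2).symm.trans (Equiv.prodCongr φ φ'), fun c => ?_⟩
      ext w
      refine mem_wordsTo_shannonProd.trans ?_
      change (∃ x ∈ (Tl 0).WordsTo (φ (c 0)), ∃ y ∈ T'.WordsTo (φ' (Fin.tail c)), x + y = w) ↔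
        ∃ s ∈ S, w = ∑ i, c i • l i + s
      rw [hφ, hφ', Fin.sum_univ_succ]
      constructor
      · rintro ⟨_, rfl, _, ⟨s, hs, rfl⟩, rfl⟩
        exact ⟨s, hs, (add_assoc _ _ _).symm⟩
      · rintro ⟨s, hs, rfl⟩
        exact ⟨_, rfl, _, ⟨s, hs, rfl⟩, (add_assoc _ _ _).symm⟩

end Trellis

/-- Every element of an additive group generated by a finite family of `𝔽₂`-vectors is a linear
combination of these vectors. -/
theorem exists_sum_smul_of_mem_closure {M : Type*} [AddCommGroup M] [Module (ZMod 2) M] {m : ℕ}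
    {l : Fin m → M} {x : M} (hx : x ∈ AddSubgroup.closure (Set.range l)) :
    ∃ c : Fin m → ZMod 2, ∑ i, c i • l i = x := by
  have hle : AddSubgroup.closure (Set.range l) ≤
      (LinearMap.range (Fintype.linearCombination (ZMod 2) l)).toAddSubgroup := by
    rw [AddSubgroup.closure_le]
    rintro _ ⟨i, rfl⟩
    exact ⟨Pi.single i 1, by simp⟩
  exact hle hx

theorem sum_smul_mem_closure {M : Type*} [AddCommGroup M] [Module (ZMod 2) M] {m : ℕ}
    (l : Fin m → M) (c : Fin m → ZMod 2) :
    ∑ i, c i • l i ∈ AddSubgroup.closure (Set.range l) := by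
  refine AddSubgroup.sum_mem _ fun i _ => ?_
  have hc : c i = 0 ∨ c i = 1 := by generalize c i = e; revert e; decide
  rcases hc with hc | hc
  · rw [hc, zero_smul]
    exact AddSubgroup.zero_mem _
  · rw [hc, one_smul]
    exact AddSubgroup.subset_closure ⟨i, rfl⟩

theorem sum_smul_injective {M : Type*} [AddCommGroup M] [Module (ZMod 2) M] {m : ℕ}
    {l : Fin m → M} (hl : ∀ s : Finset (Fin m), ∑ i ∈ s, l i = 0 → s = ∅) :
    Function.Injective fun c : Fin m → ZMod 2 => ∑ i, c i • l i := by
  intro c d hcd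
  have hsum : ∑ i, (c i - d i) • l i = 0 := by
    simpa only [sub_smul, Finset.sum_sub_distrib, sub_eq_zero] using hcd
  have hfilter : ∑ i with c i - d i ≠ 0, l i = 0 := by
    rw [← hsum, Finset.sum_filter]
    refine Finset.sum_congr rfl fun i _ => ?_
    have h : c i - d i = 0 ∨ c i - d i = 1 := by generalize c i - d i = e; revert e; decide
    rcases h with h | h <;> simp [h]
  have hempty := hl _ hfilter
  funext i
  by_contra hi
  have : i ∈ Finset.univ.filter fun i => c i - d i ≠ 0 := by simpa [sub_eq_zero] using hi
  rw [hempty] at this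
  simp at this

/-- **Shannon product of multi-goal atomic trellises with the stabilizer
trellis gives the minimal multi-goal trellis of the cosets.**
Let `S` be generated by the independent rows of `G(S)`, let `L` be generated by
the independent rows `ℓ⁽¹⁾,…,ℓ⁽²ᵏ⁾` of `G(L)` with `L ∩ S = {0}`, and suppose
the stacked matrix `G(N) = [G(S); G(L)]` is in restricted trellis-oriented
form (`G(N)` has the L-property and `G(S)` is an LR-matrix).  Let `T̂(ℓ⁽ⁱ⁾)` be
the 2-goal multi-goal atomic trellis of `ℓ⁽ⁱ⁾` (a reduced biproper multi-goal
trellis representing the pair of one-word codes `{0}` and `{ℓ⁽ⁱ⁾}`) and let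
`T_S` be the minimal (reduced biproper single-goal) trellis of the code `S`.
Then the Shannon product `T̂(ℓ⁽¹⁾) × ⋯ × T̂(ℓ⁽²ᵏ⁾) × T_S` is a reduced biproper
multi-goal trellis representing the joint code whose underlying code is
`N = L + S` and whose subcodes are the cosets of `S` in `N` (indexed by `L`);
hence it is the unique minimal multi-goal trellis of this joint code. -/
theorem shannonProd_atomic_multigoal_minimal
    {n k r : ℕ}
    (sG : Fin r → Fin n → Pauli) (lG : Fin (2 * k) → Fin n → Pauli)
    (hsInd : ∀ s : Finset (Fin r), ∑ i ∈ s, sG i = 0 → s = ∅)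
    (hlInd : ∀ s : Finset (Fin (2 * k)), ∑ i ∈ s, lG i = 0 → s = ∅)
    (S L : AddSubgroup (Fin n → Pauli))
    (hS : S = AddSubgroup.closure (Set.range sG))
    (hL : L = AddSubgroup.closure (Set.range lG))
    (hdisj : L ⊓ S = ⊥)
    (hLprop : LProperty (Fin.append sG lG))
    (hSLR : LRMatrix sG)
    (Tl : Fin (2 * k) → Trellis Pauli n)
    (hTl : ∀ i, (Tl i).Reduced ∧ (Tl i).Biproper ∧
      (Tl i).Represents ![({0} : Set (Fin n → Pauli)), {lG i}])
    (TS : Trellis Pauli n)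
    (hTS : TS.Presents (S : Set (Fin n → Pauli)) ∧ TS.Reduced ∧ TS.Biproper)
    (Cs : ↥L → Set (Fin n → Pauli))
    (hCs : ∀ ℓ : L, Cs ℓ = {w | ∃ s ∈ S, w = (ℓ : Fin n → Pauli) + s}) :
    ∀ Tp : Trellis Pauli n,
      Tp = (List.ofFn Tl).foldr Trellis.shannonProd TS →
      Tp.Reduced ∧ Tp.Biproper ∧ Tp.Represents Cs ∧
      Tp.MinimalRep Cs ∧
      ∀ T' : Trellis Pauli n, T'.MinimalRep Cs → Nonempty (Tp.Iso T') := by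
  rintro Tp rfl
  have hlead : ∀ (t : Fin n) (c : Fin (2 * k) → ZMod 2), ∀ s ∈ S,
      (∀ j ≤ t, (∑ i, c i • lG i + s) j = 0) → ∀ i, c i ≠ 0 → lG i t = 0 := by
    intro t c s hs h i hi
    obtain ⟨d, rfl⟩ := exists_sum_smul_of_mem_closure (hS ▸ hs)
    have := hLprop.eq_zero_of_sum_eq_zero t (Fin.append d c) (fun j hj => by
      rw [Fin.sum_univ_add]
      simpa [add_comm] using h j hj) t le_rfl (Fin.natAdd r i) (by simpa using hi)
    simpa using this
  obtain ⟨hR, hB, hrep⟩ := Trellis.foldr_shannonProd_atomic S TS hTS _ lG Tl hTl hlead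
  have hbij : Function.Bijective fun c : Fin (2 * k) → ZMod 2 =>
      (⟨∑ i, c i • lG i, hL ▸ sum_smul_mem_closure lG c⟩ : L) := by
    refine ⟨fun c d h => sum_smul_injective hlInd (congrArg Subtype.val h), fun ⟨x, hx⟩ => ?_⟩
    obtain ⟨c, rfl⟩ := exists_sum_smul_of_mem_closure (hL ▸ hx)
    exact ⟨c, rfl⟩
  have hrepL : ((List.ofFn Tl).foldr Trellis.shannonProd TS).Represents Cs := by
    convert hrep.comp_equiv (Equiv.ofBijective _ hbij).symm using 1
    funext ℓ
    obtain ⟨c, rfl⟩ := (Equiv.ofBijective _ hbij).surjective ℓ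
    rw [hCs, Function.comp_apply, Equiv.symm_apply_apply]
    rfl
  exact ⟨hR, hB, hrepL, hR.minimalRep hB hrepL, fun T' hT' => hR.nonempty_iso hB hrepL hT'⟩
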